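/- The transfer matrix satisfies T(λ) = T(1/λ) and T(−λ) = T(λ) for all λ ∈ ℂˣ. Moreover, with a_+(λ), d_+(λ) the diagonal entries of K_+(λ), 𝖺_+(λ) = (λ²q − q^{−1}λ^{−2})(λζ_+q^{−1/2} − q^{1/2}λ^{−1}ζ_+^{−1})/((λ²−λ^{−2})(ζ_+−ζ_+^{−1})) and 𝖽_+(λ) = (λ²q − q^{−1}λ^{−2})(ζ_+q^{1/2}λ^{−1} − λq^{−1/2}ζ_+^{−1})/((λ²−λ^{−2})(ζ_+−ζ_+^{−1})), the diagonal part T_∖(λ) := a_+(λ)A_−(λ) + d_+(λ)D_−(λ) satisfies, for all λ with λ⁴ ≠ 1: T_∖(λ) = 𝖺_+(λ)A_−(λ) + 𝖺_+(1/λ)A_−(1/λ) = 𝖽_+(λ)D_−(λ) + 𝖽_+(1/λ)D_−(1/λ). -/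

import Mathlib

open Matrix Polynomial Filter Topology

noncomputable section

namespace SixV

/-- the local space index set `ℤ/(2l+1)ℤ` -/
abbrev Zp (l : ℕ) := ZMod (2 * l + 1)

/-- index set of the quantum space `H = (ℂ^p)^{⊗N}` -/
abbrev HIdx (l N : ℕ) := Fin N → Zp l

/-- operators on the quantum space `H` -/
abbrev Op (l N : ℕ) := Matrix (HIdx l N) (HIdx l N) ℂ

/-- clock matrix `v`, `v|k⟩ = q^k |k⟩` -/
def vM (l : ℕ) (q : ℂ) : Matrix (Zp l) (Zp l) ℂ := Matrix.diagonal fun k => q ^ k.val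

def vMinv (l : ℕ) (q : ℂ) : Matrix (Zp l) (Zp l) ℂ := Matrix.diagonal fun k => (q ^ k.val)⁻¹

/-- shift matrix `u`, `u|k⟩ = |k-1⟩` -/
def uM (l : ℕ) : Matrix (Zp l) (Zp l) ℂ := Matrix.of fun j k => if j = k - 1 then (1 : ℂ) else 0

def uMinv (l : ℕ) : Matrix (Zp l) (Zp l) ℂ := Matrix.of fun j k => if j = k + 1 then (1 : ℂ) else 0

/-- the Bazhanov-Stroganov Lax operator, a `2×2` matrix of `p×p` matrices;
`s` denotes the fixed square root `q^{1/2}` of `q`. -/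
def laxM (l : ℕ) (q s pα pβ pa pb pc pd lam : ℂ) :
    Matrix (Fin 2) (Fin 2) (Matrix (Zp l) (Zp l) ℂ) :=
  Matrix.of
    ![![(lam * pα) • vM l q - (pβ / lam) • vMinv l q,
        uM l * ((pa / s) • vM l q + (s * pb) • vMinv l q)],
      ![uMinv l * ((s * pc) • vM l q + (pd / s) • vMinv l q),
        (pa * pc / pα / lam) • vM l q - (pb * pd / pβ * lam) • vMinv l q]]

/-- the bulk parameters `α_n, β_n, a_n, b_n, c_n, d_n` of the `N`-site chain -/
structure BulkParams (N : ℕ) where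
  α : Fin N → ℂ
  β : Fin N → ℂ
  a : Fin N → ℂ
  b : Fin N → ℂ
  c : Fin N → ℂ
  d : Fin N → ℂ

def BulkParams.NonZero {N : ℕ} (P : BulkParams N) : Prop :=
  ∀ n, P.α n ≠ 0 ∧ P.β n ≠ 0 ∧ P.a n ≠ 0 ∧ P.b n ≠ 0 ∧ P.c n ≠ 0 ∧ P.d n ≠ 0

/-- embedding of a one-site operator at site `n` of the chain -/
def site (l N : ℕ) (n : Fin N) (A : Matrix (Zp l) (Zp l) ℂ) : Op l N :=
  Matrix.of fun x y =>
    A (x n) (y n) * ∏ m ∈ Finset.univ.erase n, (if x m = y m then (1 : ℂ) else 0)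

def laxSite (l N : ℕ) (q s : ℂ) (P : BulkParams N) (n : Fin N) (lam : ℂ) :
    Matrix (Fin 2) (Fin 2) (Op l N) :=
  Matrix.of fun i j =>
    site l N n (laxM l q s (P.α n) (P.β n) (P.a n) (P.b n) (P.c n) (P.d n) lam i j)

/-- bulk monodromy matrix `M(λ) = L_N(λ q^{-1/2}) ⋯ L_1(λ q^{-1/2})` -/
def mono (l N : ℕ) (q s : ℂ) (P : BulkParams N) (lam : ℂ) :
    Matrix (Fin 2) (Fin 2) (Op l N) :=
  (((List.finRange N).reverse).map fun n => laxSite l N q s P n (lam / s)).prod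

/-- boundary parameters `(ζ, κ, τ)` -/
structure Bdry where
  ζ : ℂ
  κ : ℂ
  τ : ℂ

/-- the general scalar solution `K(λ; ζ, κ, τ)` of the reflection equation -/
def kM (q s : ℂ) (B : Bdry) (lam : ℂ) : Matrix (Fin 2) (Fin 2) ℂ :=
  (B.ζ - B.ζ⁻¹)⁻¹ •
    Matrix.of
      ![![lam * B.ζ / s - s / (lam * B.ζ), B.κ * Complex.exp B.τ * (lam ^ 2 / q - q / lam ^ 2)],
        ![B.κ * Complex.exp (-B.τ) * (lam ^ 2 / q - q / lam ^ 2),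
          s * B.ζ / lam - lam / (B.ζ * s)]]

/-- lift of a scalar `2×2` matrix to a `2×2` matrix of operators on `H` -/
def lift2 (l N : ℕ) (K : Matrix (Fin 2) (Fin 2) ℂ) : Matrix (Fin 2) (Fin 2) (Op l N) :=
  Matrix.of fun i j => K i j • (1 : Op l N)

/-- the Pauli matrix `σ^y` acting on the auxiliary space -/
def sigY (l N : ℕ) : Matrix (Fin 2) (Fin 2) (Op l N) :=
  Matrix.of ![![0, (-Complex.I) • (1 : Op l N)], ![Complex.I • (1 : Op l N), 0]]

/-- `M̂(λ) = (-1)^N σ^y M(1/λ)^{t_a} σ^y` (transposition in the auxiliary indices only) -/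
def mHat (l N : ℕ) (q s : ℂ) (P : BulkParams N) (lam : ℂ) :
    Matrix (Fin 2) (Fin 2) (Op l N) :=
  ((-1 : ℂ) ^ N) • (sigY l N * (mono l N q s P lam⁻¹).transpose * sigY l N)

/-- the boundary monodromy matrix `U_-(λ) = M(λ) K_-(λ) M̂(λ)` -/
def uBdry (l N : ℕ) (q s : ℂ) (P : BulkParams N) (Bm : Bdry) (lam : ℂ) :
    Matrix (Fin 2) (Fin 2) (Op l N) :=
  mono l N q s P lam * lift2 l N (kM q s Bm lam) * mHat l N q s P lam

def opA (l N : ℕ) (q s : ℂ) (P : BulkParams N) (Bm : Bdry) (lam : ℂ) : Op l N :=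
  uBdry l N q s P Bm lam 0 0
def opB (l N : ℕ) (q s : ℂ) (P : BulkParams N) (Bm : Bdry) (lam : ℂ) : Op l N :=
  uBdry l N q s P Bm lam 0 1
def opC (l N : ℕ) (q s : ℂ) (P : BulkParams N) (Bm : Bdry) (lam : ℂ) : Op l N :=
  uBdry l N q s P Bm lam 1 0
def opD (l N : ℕ) (q s : ℂ) (P : BulkParams N) (Bm : Bdry) (lam : ℂ) : Op l N :=
  uBdry l N q s P Bm lam 1 1

/-- transfer matrix with the general boundary matrix `K_+(λ) = K(λq; ζ_+, κ_+, τ_+)` -/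
def transferGen (l N : ℕ) (q s : ℂ) (P : BulkParams N) (Bp Bm : Bdry) (lam : ℂ) : Op l N :=
  (lift2 l N (kM q s Bp (lam * q)) * uBdry l N q s P Bm lam).trace

/-- the upper-triangular `K_+` boundary matrix: `K(λq; ζ_+, κ_+, τ_+)` with `(1,2)` entry `0` -/
def kTriPlus (q s : ℂ) (B : Bdry) (lam : ℂ) : Matrix (Fin 2) (Fin 2) ℂ :=
  Matrix.of ![![kM q s B (lam * q) 0 0, 0], ![kM q s B (lam * q) 1 0, kM q s B (lam * q) 1 1]]

/-- transfer matrix with triangular `K_+` -/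
def transferTri (l N : ℕ) (q s : ℂ) (P : BulkParams N) (Bp Bm : Bdry) (lam : ℂ) : Op l N :=
  (lift2 l N (kTriPlus q s Bp lam) * uBdry l N q s P Bm lam).trace

/-- the scalar value `d_q M(λ)` of the bulk quantum determinant -/
def dqM (N : ℕ) (q : ℂ) (P : BulkParams N) (lam : ℂ) : ℂ :=
  (-q) ^ N * ∏ n, (P.β n * P.a n * P.c n / P.α n *
    (lam⁻¹ + q⁻¹ * P.b n * P.α n * lam / (P.a n * P.β n)) *
    (lam⁻¹ + q⁻¹ * P.d n * P.α n * lam / (P.c n * P.β n)))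

/-- the bulk function `a(λ)` -/
def aBulk (N : ℕ) (q a0 : ℂ) (P : BulkParams N) (lam : ℂ) : ℂ :=
  a0 * ∏ n, (P.β n / lam + q⁻¹ * P.b n * P.α n * lam / P.a n)

/-- the bulk function `d(λ)` -/
def dBulk (N : ℕ) (q a0 : ℂ) (P : BulkParams N) (lam : ℂ) : ℂ :=
  ((-1 : ℂ) ^ N / a0) *
    ∏ n, (P.a n * P.c n / P.α n * (lam⁻¹ + q * P.d n * P.α n * lam / (P.c n * P.β n)))

/-- the boundary function `g_-(λ)` -/
def gMin (s αm βm lam : ℂ) : ℂ :=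
  (lam * αm / s - s / (lam * αm)) * (lam * βm / s + s / (lam * βm)) /
    ((αm - αm⁻¹) * (βm + βm⁻¹))

/-- the function `𝖠_-(λ) = g_-(λ) a(λ q^{-1/2}) d(q^{-1/2} λ^{-1})` -/
def AAm (N : ℕ) (q s a0 αm βm : ℂ) (P : BulkParams N) (lam : ℂ) : ℂ :=
  gMin s αm βm lam * aBulk N q a0 P (lam / s) * dBulk N q a0 P (s * lam)⁻¹

/-- `a_0 = (-q)^N ∏_n q^{-j_n}` -/
def a0def (N : ℕ) (q : ℂ) (j : Fin N → ℕ) : ℂ := (-q) ^ N * ∏ n, (q ^ (j n))⁻¹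

/-- the coefficient `𝖺_+(λ)` -/
def aPl (q s ζp lam : ℂ) : ℂ :=
  (lam ^ 2 * q - 1 / (q * lam ^ 2)) * (lam * ζp / s - s / (lam * ζp)) /
    ((lam ^ 2 - 1 / lam ^ 2) * (ζp - ζp⁻¹))

/-- the coefficient `𝖽_+(λ)` -/
def dPl (q s ζp lam : ℂ) : ℂ :=
  (lam ^ 2 * q - 1 / (q * lam ^ 2)) * (ζp * s / lam - lam / (s * ζp)) /
    ((lam ^ 2 - 1 / lam ^ 2) * (ζp - ζp⁻¹))

/-- the function `k(λ)` -/
def kFun (q lam : ℂ) : ℂ := (lam ^ 2 - 1 / lam ^ 2) / (lam ^ 2 / q ^ 2 - q ^ 2 / lam ^ 2)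

/-- the separation points `ξ_n^{(h)} = μ_{n,+} q^{h+1/2}` -/
def xiP (N : ℕ) (q s : ℂ) (muP : Fin N → ℂ) (n : Fin N) (h : ℕ) : ℂ := muP n * q ^ h * s

/-- `X_n^{(h)} = (ξ_n^{(h)})^2 + (ξ_n^{(h)})^{-2}` -/
def XVal (N : ℕ) (q s : ℂ) (muP : Fin N → ℂ) (n : Fin N) (h : ℕ) : ℂ :=
  (xiP N q s muP n h) ^ 2 + ((xiP N q s muP n h) ^ 2)⁻¹

/-- the `B_-`-eigenvalue function `b_h(λ)` -/
def bEig (N : ℕ) (q s : ℂ) (Bm : Bdry) (P : BulkParams N) (muP : Fin N → ℂ)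
    (h : Fin N → ℕ) (lam : ℂ) : ℂ :=
  Bm.κ * Complex.exp Bm.τ * ((lam ^ 2 / q - q / lam ^ 2) / (Bm.ζ - Bm.ζ⁻¹)) *
    ∏ n, (P.α n * P.β n *
      (lam / xiP N q s muP n (h n) - xiP N q s muP n (h n) / lam) *
      ((lam * xiP N q s muP n (h n))⁻¹ - lam * xiP N q s muP n (h n)))

/-- the reference covector `⟨Ω| = ⊗_n ⟨j_n - 1|` -/
def refL (l N : ℕ) (j : Fin N → ℕ) : HIdx l N → ℂ :=
  fun x => ∏ n, (if x n = (j n : Zp l) - 1 then (1 : ℂ) else 0)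

/-- the reference vector `|Ω̄⟩ = ⊗_n |j_n⟩` -/
def refR (l N : ℕ) (j : Fin N → ℕ) : HIdx l N → ℂ :=
  fun x => ∏ n, (if x n = (j n : Zp l) then (1 : ℂ) else 0)

/-- the operator `∏_n ∏_{k=1}^{h_n} A_-(1/ξ_n^{(k-1)}) / 𝖠_-(1/ξ_n^{(k-1)})` -/
def leftOp (l N : ℕ) (q s a0 αm βm : ℂ) (P : BulkParams N) (Bm : Bdry) (muP : Fin N → ℂ)
    (h : Fin N → ℕ) : Op l N :=
  ((List.finRange N).map fun n =>
    (((List.range (h n)).map fun k =>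
      (AAm N q s a0 αm βm P ((xiP N q s muP n k)⁻¹))⁻¹ •
        opA l N q s P Bm ((xiP N q s muP n k)⁻¹)).prod)).prod

/-- the left SoV covector `⟨h|` -/
def leftSoV (l N : ℕ) (q s a0 αm βm : ℂ) (P : BulkParams N) (Bm : Bdry) (muP : Fin N → ℂ)
    (j h : Fin N → ℕ) : HIdx l N → ℂ :=
  Matrix.vecMul (refL l N j) (leftOp l N q s a0 αm βm P Bm muP h)

/-- the operator `∏_n ∏_{k=h_n}^{p-2} D_-(ξ_n^{(k+1)})/(k(ξ_n^{(k+1)}) 𝖠_-(1/ξ_n^{(k)}))` -/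
def rightOp (l N : ℕ) (q s a0 αm βm : ℂ) (P : BulkParams N) (Bm : Bdry) (muP : Fin N → ℂ)
    (h : Fin N → ℕ) : Op l N :=
  ((List.finRange N).map fun n =>
    (((List.range' (h n) (2 * l - h n)).map fun k =>
      (kFun q (xiP N q s muP n (k + 1)) * AAm N q s a0 αm βm P ((xiP N q s muP n k)⁻¹))⁻¹ •
        opD l N q s P Bm (xiP N q s muP n (k + 1))).prod)).prod

/-- the right SoV vector `|h⟩` -/
def rightSoV (l N : ℕ) (q s a0 αm βm : ℂ) (P : BulkParams N) (Bm : Bdry) (muP : Fin N → ℂ)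
    (j h : Fin N → ℕ) : HIdx l N → ℂ :=
  Matrix.mulVec (rightOp l N q s a0 αm βm P Bm muP h) (refR l N j)

/-- the condition (E-SOV) -/
def ESOV (N p : ℕ) (muP : Fin N → ℂ) : Prop :=
  ∀ n m : Fin N, n ≠ m → (muP n) ^ p ≠ (muP m) ^ p

/-- the condition (SoV-2) -/
def SOV2 (N l : ℕ) (q αm βm : ℂ) (muP muM : Fin N → ℂ) : Prop :=
  (∀ n, (muP n) ^ (2 * (2 * l + 1)) ≠ 1 ∧ (muP n) ^ (2 * (2 * l + 1)) ≠ -1) ∧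
  (∀ ε : ℤ, ε = 1 ∨ ε = -1 → ∀ h : ℕ, 1 ≤ h → h ≤ 2 * l → ∀ n m : Fin N,
    (muP n) ^ 2 ≠ q ^ (-2 * (h : ℤ)) * αm ^ (2 * ε) ∧
    (muP n) ^ 2 ≠ -(q ^ (-2 * (h : ℤ)) * βm ^ (2 * ε)) ∧
    (muP n) ^ 2 ≠ q ^ (-2 * ε - 2 * (h : ℤ)) * (muM m) ^ (2 * ε))

/-- the condition (cond-simple) -/
def CondSimple (N l : ℕ) (q ζp : ℂ) (muP : Fin N → ℂ) : Prop :=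
  ∀ h : ℕ, 1 ≤ h → h ≤ 2 * l → ∀ n : Fin N,
    (muP n) ^ 2 ≠ q ^ (-2 * (h : ℤ)) * ζp ^ 2 ∧
    (muP n) ^ 2 ≠ q ^ (-2 * (h : ℤ)) * ζp ^ (-2 : ℤ)

/-- the Vandermonde product `∏_{1 ≤ b < a ≤ N} (x_a - x_b)` -/
def vdm (N : ℕ) (x : Fin N → ℂ) : ℂ := ∏ a : Fin N, ∏ b ∈ Finset.Iio a, (x a - x b)

/-- the `p×p` Baxter matrix `D_{τ,f}(λ)` -/
def dMat (l : ℕ) (q : ℂ) (tf ff : ℂ → ℂ) (lam : ℂ) : Matrix (Zp l) (Zp l) ℂ :=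
  Matrix.of fun j k =>
    if k = j then tf (q ^ j.val * lam)
    else if k = j + 1 then -ff ((q ^ j.val * lam)⁻¹)
    else if k = j - 1 then -ff (q ^ j.val * lam)
    else 0

/-- the coefficient `𝖺(λ) = 𝖺_+(λ) 𝖠_-(λ)` -/
def sfA (N : ℕ) (q s a0 αm βm ζp : ℂ) (P : BulkParams N) (lam : ℂ) : ℂ :=
  aPl q s ζp lam * AAm N q s a0 αm βm P lam

/-- the coefficient `ā(λ) = λ q^{-1/2} 𝖺(λ)` -/
def sfAbar (N : ℕ) (q s a0 αm βm ζp : ℂ) (P : BulkParams N) (lam : ℂ) : ℂ :=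
  lam / s * sfA N q s a0 αm βm ζp P lam

/-- the coefficient `𝖽(λ) = 𝖽_+(λ) 𝖣_-(λ)`, `𝖣_-(λ) = k(λ) 𝖠_-(q/λ)` -/
def sfD (N : ℕ) (q s a0 αm βm ζp : ℂ) (P : BulkParams N) (lam : ℂ) : ℂ :=
  dPl q s ζp lam * (kFun q lam * AAm N q s a0 αm βm P (q / lam))

/-- the asymptotic value `τ_∞` for the general transfer matrix -/
def tauInfGen (N : ℕ) (q : ℂ) (Bp Bm : Bdry) (P : BulkParams N) : ℂ :=
  Bp.κ * Bm.κ *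
    (Complex.exp (Bp.τ - Bm.τ) * (∏ n, (P.b n * P.d n / P.β n * (P.a n * P.c n / P.α n))) +
     Complex.exp (Bm.τ - Bp.τ) * (∏ n, (P.α n * P.β n))) /
    ((Bp.ζ - Bp.ζ⁻¹) * (Bm.ζ - Bm.ζ⁻¹))

/-- the asymptotic value `τ_∞` for the triangular `K_+` transfer matrix -/
def tauInfTri (N : ℕ) (Bp Bm : Bdry) (P : BulkParams N) : ℂ :=
  (-1 : ℂ) ^ N * Bp.κ * Bm.κ * Complex.exp (Bm.τ - Bp.τ) * (∏ n, (P.α n * P.β n)) /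
    ((Bp.ζ - Bp.ζ⁻¹) * (Bm.ζ - Bm.ζ⁻¹))

/-- the function `F(λ)` -/
def Ff (l N : ℕ) (q s : ℂ) (muP : Fin N → ℂ) (lam : ℂ) : ℂ :=
  ∏ n : Fin N,
    ((lam ^ (2 * l + 1) / (xiP N q s muP n 0) ^ (2 * l + 1) -
        (xiP N q s muP n 0) ^ (2 * l + 1) / lam ^ (2 * l + 1)) *
     (lam ^ (2 * l + 1) * (xiP N q s muP n 0) ^ (2 * l + 1) -
        (lam ^ (2 * l + 1) * (xiP N q s muP n 0) ^ (2 * l + 1))⁻¹))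

/-- the asymptotic value `ā_∞` -/
def abarInf (N : ℕ) (q αm βm : ℂ) (Bp Bm : Bdry) (P : BulkParams N) : ℂ :=
  (-1 : ℂ) ^ N * αm * βm * Bp.ζ * Bm.κ * (∏ n, (P.b n * P.c n)) /
    (q ^ (1 + N) * (Bp.ζ - Bp.ζ⁻¹) * (Bm.ζ - Bm.ζ⁻¹))

/-- the inhomogeneity `G(λ | x, y)` -/
def Gf (l N : ℕ) (q s a0 αm βm : ℂ) (Bp Bm : Bdry) (P : BulkParams N) (muP : Fin N → ℂ)
    (lam x y : ℂ) : ℂ :=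
  Ff l N q s muP lam *
    ((tauInfTri N Bp Bm P - q ^ (-(4 * (l : ℤ) * N)) * abarInf N q αm βm Bp Bm P) * x *
        ((lam / s - s / lam) * (s * lam - (s * lam)⁻¹) *
         (lam / (Complex.I * s) - Complex.I * s / lam) *
         (Complex.I * s * lam - (Complex.I * s * lam)⁻¹)) +
      (Complex.I - 1) * y * sfA N q s a0 αm βm Bp.ζ P (Complex.I * s) /
          (4 * Ff l N q s muP (Complex.I * s)) *
        ((lam * s - (lam * s)⁻¹) * (lam / s - (lam / s)⁻¹)))

/-- `τ` is an eigenvalue function of the family `T`, i.e. `τ ∈ Σ_T` -/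
def inSpec (l N : ℕ) (T : ℂ → Op l N) (tf : ℂ → ℂ) : Prop :=
  ∃ w : HIdx l N → ℂ, w ≠ 0 ∧ ∀ lam : ℂ, lam ≠ 0 → Matrix.mulVec (T lam) w = tf lam • w

/-- the joint eigenspace `E_τ` of the family `T` -/
def eigSp (l N : ℕ) (T : ℂ → Op l N) (tf : ℂ → ℂ) : Submodule ℂ (HIdx l N → ℂ) :=
  ⨅ lam : {x : ℂ // x ≠ 0},
    Module.End.eigenspace (Matrix.mulVecLin (T lam.1)) (tf lam.1)

/-- the admissible functional form of transfer matrix eigenvalues -/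
def admissible (N : ℕ) (q s tinf : ℂ) (Bp Bm : Bdry) (P : BulkParams N) (tf : ℂ → ℂ) : Prop :=
  (∃ Pol : Polynomial ℂ, Pol.degree ≤ ((N + 2 : ℕ) : WithBot ℕ) ∧
      Pol.coeff (N + 2) = tinf ∧
      ∀ lam : ℂ, lam ≠ 0 → tf lam = Pol.eval (lam ^ 2 + (lam ^ 2)⁻¹)) ∧
  tf s = (-1 : ℂ) ^ N * (q + q⁻¹) * dqM N q P 1 ∧
  tf (Complex.I * s) = (-1 : ℂ) ^ N * (q + q⁻¹) *
    ((Bp.ζ + Bp.ζ⁻¹) * (Bm.ζ + Bm.ζ⁻¹) / ((Bp.ζ - Bp.ζ⁻¹) * (Bm.ζ - Bm.ζ⁻¹))) *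
    dqM N q P Complex.I

/-- the separate state with coefficients `Q_a^{(h_a)}` in the right SoV basis -/
def sovVec (l N : ℕ) (q s a0 αm βm : ℂ) (P : BulkParams N) (Bm : Bdry) (muP : Fin N → ℂ)
    (j : Fin N → ℕ) (Q : Fin N → Zp l → ℂ) : HIdx l N → ℂ :=
  ∑ h : Fin N → Fin (2 * l + 1),
    ((∏ a, Q a ((h a : ℕ) : Zp l)) * vdm N (fun a => XVal N q s muP a ((h a : ℕ)))) •
      rightSoV l N q s a0 αm βm P Bm muP j (fun n => (h n : ℕ))

/-- the renormalized operator `B̂_-(λ)` -/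
def bHatOp (l N : ℕ) (q s : ℂ) (P : BulkParams N) (Bm : Bdry) (lam : ℂ) : Op l N :=
  ((Bm.ζ - Bm.ζ⁻¹) /
      (Bm.κ * Complex.exp Bm.τ * (lam ^ 2 / q - q / lam ^ 2) * ∏ n, (P.α n * P.β n))) •
    opB l N q s P Bm lam

/-- the state `|ω̄⟩` -/
def omegaBar (l N : ℕ) (q s a0 αm βm : ℂ) (P : BulkParams N) (Bm : Bdry) (muP : Fin N → ℂ)
    (j : Fin N → ℕ) : HIdx l N → ℂ :=
  ∑ h : Fin N → Fin (2 * l + 1),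
    (vdm N (fun a => XVal N q s muP a ((h a : ℕ)))) •
      rightSoV l N q s a0 αm βm P Bm muP j (fun n => (h n : ℕ))

/-- the recursively defined coefficients `t^{(h)}`:
`t^{(0)} = 1`, `t^{(1)} = F 0`, `t^{(h+2)} = F(h+1) t^{(h+1)} - G(h+1) t^{(h)}` -/
def tseq (F G : ℕ → ℂ) : ℕ → ℂ
  | 0 => 1
  | 1 => F 0
  | (h + 2) => F (h + 1) * tseq F G (h + 1) - G (h + 1) * tseq F G h

end SixV
namespace SixV

section local_rel
variable {l : ℕ} {q : ℂ}

lemma v_mul_vinv (h : q ≠ 0) : vM l q * vMinv l q = 1 := by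
  simp [vM, vMinv, h]

lemma vinv_mul_v (h : q ≠ 0) : vMinv l q * vM l q = 1 := by
  simp [vM, vMinv, h]

lemma u_mul_uinv : uM l * uMinv l = 1 := by
  ext i j
  simp [uM, uMinv, Matrix.mul_apply, Matrix.one_apply, eq_sub_iff_add_eq, eq_comm]

lemma uinv_mul_u : uMinv l * uM l = 1 := by
  ext i j
  simp [uM, uMinv, Matrix.mul_apply, Matrix.one_apply]

lemma qpow_add_one (h1 : q ^ (2 * l + 1) = 1) (k : Zp l) :
    q ^ (k + 1).val = q ^ k.val * q := by
  rw [← pow_succ, ZMod.val_add, ← pow_mod_orderOf q (k.val + 1), ← pow_mod_orderOf q]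
  congr 1
  rw [Nat.mod_mod_of_dvd _ (orderOf_dvd_of_pow_eq_one h1)]
  rcases Nat.eq_zero_or_pos l with h | h
  · subst h
    have : q = 1 := by simpa using h1
    subst this; simp [Nat.mod_one]
  · rw [ZMod.val_one'' (by omega)]

lemma v_mul_u (h : q ≠ 0) (h1 : q ^ (2 * l + 1) = 1) : vM l q * uM l = q⁻¹ • (uM l * vM l q) := by
  ext i j
  simp only [vM, uM, Matrix.diagonal_mul, Matrix.mul_diagonal, Matrix.smul_apply, Matrix.of_apply]
  split_ifs with hij
  · have := qpow_add_one h1 i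
    have hj : i + 1 = j := by rw [hij]; ring
    rw [← hj, this]; simp; field_simp
  · simp

lemma vinv_mul_u (h : q ≠ 0) (h1 : q ^ (2 * l + 1) = 1) :
    vMinv l q * uM l = q • (uM l * vMinv l q) := by
  ext i j
  simp only [vMinv, uM, Matrix.diagonal_mul, Matrix.mul_diagonal, Matrix.smul_apply, Matrix.of_apply]
  split_ifs with hij
  · have := qpow_add_one h1 i
    have hj : i + 1 = j := by rw [hij]; ring
    rw [← hj, this]; simp; field_simp
  · simp

lemma v_mul_uinv (h : q ≠ 0) (h1 : q ^ (2 * l + 1) = 1) :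
    vM l q * uMinv l = q • (uMinv l * vM l q) := by
  ext i j
  simp only [vM, uMinv, Matrix.diagonal_mul, Matrix.mul_diagonal, Matrix.smul_apply, Matrix.of_apply]
  split_ifs with hij
  · have := qpow_add_one h1 j
    rw [hij, this]; simp; ring
  · simp

lemma vinv_mul_uinv (h : q ≠ 0) (h1 : q ^ (2 * l + 1) = 1) :
    vMinv l q * uMinv l = q⁻¹ • (uMinv l * vMinv l q) := by
  ext i j
  simp only [vMinv, uMinv, Matrix.diagonal_mul, Matrix.mul_diagonal, Matrix.smul_apply, Matrix.of_apply]
  split_ifs with hij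
  · have := qpow_add_one h1 j
    rw [hij, this]; simp
  · simp

end local_rel

/-- the local exchange identities between the entries of `L(λ)` and of `L(1/λ)` -/
structure LocId {R : Type*} [Ring R] [Algebra ℂ R] (p r z : ℂ) (L L' : Matrix (Fin 2) (Fin 2) R) :
    Prop where
  e00_00 : -(p • (L 0 0 * L' 1 1)) + r • (L 1 0 * L' 0 1)
    = -(p • (L' 0 0 * L 1 1)) + r • (L' 0 1 * L 1 0)
  e00_11 : p • (L 0 1 * L' 1 0) - r • (L 1 1 * L' 0 0)
    = -(r • (L' 0 0 * L 1 1)) + p • (L' 0 1 * L 1 0)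
  e00_01 : p • (L 0 0 * L' 1 0) - r • (L 1 0 * L' 0 0) = z • (L' 0 0 * L 1 0)
  e00_10 : -(p • (L 0 1 * L' 1 1)) + r • (L 1 1 * L' 0 1) = -(z • (L' 0 1 * L 1 1))
  e11_00 : -(r • (L 0 0 * L' 1 1)) + p • (L 1 0 * L' 0 1)
    = p • (L' 1 0 * L 0 1) - r • (L' 1 1 * L 0 0)
  e11_11 : r • (L 0 1 * L' 1 0) - p • (L 1 1 * L' 0 0)
    = r • (L' 1 0 * L 0 1) - p • (L' 1 1 * L 0 0)
  e11_01 : r • (L 0 0 * L' 1 0) - p • (L 1 0 * L' 0 0) = -(z • (L' 1 0 * L 0 0))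
  e11_10 : -(r • (L 0 1 * L' 1 1)) + p • (L 1 1 * L' 0 1) = z • (L' 1 1 * L 0 1)
  e01_00 : z • (L 0 0 * L' 0 1) = p • (L' 0 0 * L 0 1) - r • (L' 0 1 * L 0 0)
  e01_11 : -(z • (L 0 1 * L' 0 0)) = r • (L' 0 0 * L 0 1) - p • (L' 0 1 * L 0 0)
  e01_01 : L 0 0 * L' 0 0 = L' 0 0 * L 0 0
  e01_10 : L 0 1 * L' 0 1 = L' 0 1 * L 0 1
  e10_00 : -(z • (L 1 0 * L' 1 1)) = -(p • (L' 1 0 * L 1 1)) + r • (L' 1 1 * L 1 0)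
  e10_11 : z • (L 1 1 * L' 1 0) = -(r • (L' 1 0 * L 1 1)) + p • (L' 1 1 * L 1 0)
  e10_01 : L 1 0 * L' 1 0 = L' 1 0 * L 1 0
  e10_10 : L 1 1 * L' 1 1 = L' 1 1 * L 1 1

set_option maxHeartbeats 4000000 in
lemma laxM_locId (l : ℕ) (q s pα pβ pa pb pc pd lam : ℂ) (hs : s ^ 2 = q) (hq0 : q ≠ 0)
    (hq : q ^ (2 * l + 1) = 1) (hα : pα ≠ 0) (hβ : pβ ≠ 0) (hlam : lam ≠ 0) :
    LocId (q⁻¹ - q) (lam ^ 2 - (lam ^ 2)⁻¹) (-(q * lam ^ 2 - (q * lam ^ 2)⁻¹))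
      (laxM l q s pα pβ pa pb pc pd (lam / s)) (laxM l q s pα pβ pa pb pc pd (lam⁻¹ / s)) := by
  have hs0 : s ≠ 0 := by rintro rfl; simp at hs; exact hq0 hs.symm
  have a1 := v_mul_vinv (l := l) hq0
  have a2 := vinv_mul_v (l := l) hq0
  have a3 := u_mul_uinv (l := l)
  have a4 := uinv_mul_u (l := l)
  have a5 := v_mul_u (l := l) hq0 hq
  have a6 := vinv_mul_u (l := l) hq0 hq
  have a7 := v_mul_uinv (l := l) hq0 hq
  have a8 := vinv_mul_uinv (l := l) hq0 hq
  have b1 : ∀ X, vM l q * (vMinv l q * X) = X := fun X => by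
    rw [← mul_assoc, a1, one_mul]
  have b2 : ∀ X, vMinv l q * (vM l q * X) = X := fun X => by
    rw [← mul_assoc, a2, one_mul]
  have b3 : ∀ X, uM l * (uMinv l * X) = X := fun X => by
    rw [← mul_assoc, a3, one_mul]
  have b4 : ∀ X, uMinv l * (uM l * X) = X := fun X => by
    rw [← mul_assoc, a4, one_mul]
  have b5 : ∀ X, vM l q * (uM l * X) = q⁻¹ • (uM l * (vM l q * X)) := fun X => by
    rw [← mul_assoc, a5, smul_mul_assoc, mul_assoc]
  have b6 : ∀ X, vMinv l q * (uM l * X) = q • (uM l * (vMinv l q * X)) := fun X => by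
    rw [← mul_assoc, a6, smul_mul_assoc, mul_assoc]
  have b7 : ∀ X, vM l q * (uMinv l * X) = q • (uMinv l * (vM l q * X)) := fun X => by
    rw [← mul_assoc, a7, smul_mul_assoc, mul_assoc]
  have b8 : ∀ X, vMinv l q * (uMinv l * X) = q⁻¹ • (uMinv l * (vMinv l q * X)) := fun X => by
    rw [← mul_assoc, a8, smul_mul_assoc, mul_assoc]
  unfold laxM
  generalize vM l q = v at *
  generalize vMinv l q = w at *
  generalize uM l = u at *
  generalize uMinv l = t at *
  subst hs
  constructor <;>
  · simp only [Matrix.of_apply, Matrix.cons_val', Matrix.cons_val_zero, Matrix.cons_val_one,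
      mul_add, add_mul, mul_sub, sub_mul, smul_mul_assoc, mul_smul_comm,
      mul_assoc, a1, a2, a3, a4, a5, a6, a7, a8, b1, b2, b3, b4, b5, b6, b7, b8,
      mul_one]
    all_goals (match_scalars <;> field_simp <;> ring)



section site_lemmas
variable {l N : ℕ}

lemma site_update (n : Fin N) (A : Matrix (Zp l) (Zp l) ℂ) (x y : HIdx l N) (k : Zp l) :
    site l N n A (Function.update x n k) y =
      A k (y n) * ∏ m ∈ Finset.univ.erase n, (if x m = y m then (1 : ℂ) else 0) := by
  simp only [site, Matrix.of_apply, Function.update_self]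
  congr 1
  refine Finset.prod_congr rfl fun m hm => ?_
  rw [Function.update_of_ne (Finset.ne_of_mem_erase hm)]

lemma site_apply_update (n : Fin N) (A : Matrix (Zp l) (Zp l) ℂ) (x : HIdx l N) (k : Zp l) :
    site l N n A x (Function.update x n k) = A (x n) k := by
  simp only [site, Matrix.of_apply, Function.update_self]
  rw [Finset.prod_eq_one, mul_one]
  intro m hm
  rw [Function.update_of_ne (Finset.ne_of_mem_erase hm)]
  simp

lemma site_mul_apply (n : Fin N) (A : Matrix (Zp l) (Zp l) ℂ) (B : Op l N) (x y : HIdx l N) :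
    (site l N n A * B) x y = ∑ k, A (x n) k * B (Function.update x n k) y := by
  rw [Matrix.mul_apply]
  symm
  refine Fintype.sum_of_injective (fun k => Function.update x n k)
    (Function.update_injective x n) _ _ ?_ ?_
  · intro z hz
    have : ∃ m, m ≠ n ∧ x m ≠ z m := by
      by_contra! hcon
      apply hz
      refine ⟨z n, ?_⟩
      funext m
      by_cases hm : m = n
      · subst hm; simp
      · simp [Function.update_of_ne hm, hcon m hm]
    obtain ⟨m, hm, hxz⟩ := this
    have : site l N n A x z = 0 := by
      simp only [site, Matrix.of_apply]
      rw [Finset.prod_eq_zero (i := m) (by simp [hm]) (by simp [hxz]), mul_zero]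
    rw [this, zero_mul]
  · intro k
    rw [site_apply_update]

lemma site_mul (n : Fin N) (A B : Matrix (Zp l) (Zp l) ℂ) :
    site l N n (A * B) = site l N n A * site l N n B := by
  ext x y
  rw [site_mul_apply]
  simp only [site_update]
  simp only [site, Matrix.of_apply, Matrix.mul_apply, Finset.sum_mul, mul_assoc]

lemma site_add (n : Fin N) (A B : Matrix (Zp l) (Zp l) ℂ) :
    site l N n (A + B) = site l N n A + site l N n B := by
  ext x y
  simp [site, add_mul]

lemma site_smul (n : Fin N) (c : ℂ) (A : Matrix (Zp l) (Zp l) ℂ) :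
    site l N n (c • A) = c • site l N n A := by
  ext x y
  simp [site, mul_assoc]

lemma site_neg (n : Fin N) (A : Matrix (Zp l) (Zp l) ℂ) :
    site l N n (-A) = -site l N n A := by
  ext x y
  simp [site]

lemma site_sub (n : Fin N) (A B : Matrix (Zp l) (Zp l) ℂ) :
    site l N n (A - B) = site l N n A - site l N n B := by
  rw [sub_eq_add_neg, site_add, site_neg, sub_eq_add_neg]

lemma site_mul_site_apply {n m : Fin N} (h : n ≠ m) (A B : Matrix (Zp l) (Zp l) ℂ)
    (x y : HIdx l N) :
    (site l N n A * site l N m B) x y = A (x n) (y n) * B (x m) (y m) *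
      ∏ j ∈ (Finset.univ.erase n).erase m, (if x j = y j then (1 : ℂ) else 0) := by
  rw [site_mul_apply, Finset.sum_eq_single (y n)]
  · simp only [site, Matrix.of_apply]
    rw [Function.update_of_ne h.symm, mul_assoc]
    congr 2
    rw [← Finset.mul_prod_erase (Finset.univ.erase m) _ (a := n) (by simp [h])]
    rw [Function.update_self, if_pos rfl, one_mul, Finset.erase_right_comm]
    refine Finset.prod_congr rfl fun j hj => ?_
    rw [Function.update_of_ne (by simp at hj; exact hj.2)]
  · intro k _ hk
    simp only [site, Matrix.of_apply]
    rw [Finset.prod_eq_zero (i := n) (by simp [h]) (by simp [hk])]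
    simp
  · simp

lemma site_commute {n m : Fin N} (h : n ≠ m) (A B : Matrix (Zp l) (Zp l) ℂ) :
    Commute (site l N n A) (site l N m B) := by
  ext x y
  rw [site_mul_site_apply h, site_mul_site_apply h.symm, Finset.erase_right_comm]
  ring

end site_lemmas

lemma laxSite_locId (l N : ℕ) (q s : ℂ) (P : BulkParams N) (hP : P.NonZero) (n : Fin N) (lam : ℂ)
    (hs : s ^ 2 = q) (hq0 : q ≠ 0) (hq : q ^ (2 * l + 1) = 1) (hlam : lam ≠ 0) :
    LocId (q⁻¹ - q) (lam ^ 2 - (lam ^ 2)⁻¹) (-(q * lam ^ 2 - (q * lam ^ 2)⁻¹))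
      (laxSite l N q s P n (lam / s)) (laxSite l N q s P n (lam⁻¹ / s)) := by
  have h := laxM_locId l q s (P.α n) (P.β n) (P.a n) (P.b n) (P.c n) (P.d n) lam hs hq0 hq
    (hP n).1 (hP n).2.1 hlam
  constructor <;>
    simp only [laxSite, Matrix.of_apply, ← site_mul, ← site_smul, ← site_add, ← site_neg,
      ← site_sub] <;> refine congrArg (site l N n) ?_
  exacts [h.e00_00, h.e00_11, h.e00_01, h.e00_10, h.e11_00, h.e11_11, h.e11_01, h.e11_10,
    h.e01_00, h.e01_11, h.e01_01, h.e01_10, h.e10_00, h.e10_11, h.e10_01, h.e10_10]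



section dressing
variable {R : Type*} [Ring R] [Algebra ℂ R]

/-- `σ^y Mᵗ σ^y` -/
def adj2 (M : Matrix (Fin 2) (Fin 2) R) : Matrix (Fin 2) (Fin 2) R :=
  Matrix.of ![![M 1 1, -M 0 1], ![-M 1 0, M 0 0]]

lemma adj2_mul (L M : Matrix (Fin 2) (Fin 2) R) (h : ∀ i j k m, Commute (L i j) (M k m)) :
    adj2 (L * M) = adj2 M * adj2 L := by
  have h' := fun i j k m => (h i j k m).eq
  ext i j
  fin_cases i <;> fin_cases j <;>
    simp [adj2, Matrix.mul_apply, Fin.sum_univ_two, h'] <;> abel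

/-- the relation between `U(λ)` and `U(1/λ)` -/
structure Rel (w p r z : ℂ) (U U' : Matrix (Fin 2) (Fin 2) R) : Prop where
  e00 : w • U' 0 0 = p • U 0 0 + r • U 1 1
  e11 : w • U' 1 1 = r • U 0 0 + p • U 1 1
  e01 : w • U' 0 1 = z • U 0 1
  e10 : w • U' 1 0 = z • U 1 0

lemma Rel.dress {w p r z : ℂ} {U U' L L' : Matrix (Fin 2) (Fin 2) R} (h : Rel w p r z U U')
    (hL : LocId p r z L L')
    (h1 : ∀ i j k m, Commute (L i j) (U' k m))
    (h2 : ∀ i j k m, Commute (L' i j) (U k m)) :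
    Rel w p r z (L * U * -adj2 L') (L' * U' * -adj2 L) := by
  have h1' := fun i j k m => (h1 i j k m).eq.symm
  have h2' := fun i j k m => (h2 i j k m).eq.symm
  have key : ∀ x : R, ∀ k m, w • (x * U' k m) = x * (w • U' k m) :=
    fun x k m => (mul_smul_comm _ _ _).symm
  have ex : ∀ {x y : R} (u : R), x = y → x * u = y * u := fun u h => by rw [h]
  constructor <;>
    simp only [adj2, Matrix.mul_apply, Fin.sum_univ_two, Matrix.neg_apply, Matrix.of_apply,
      Matrix.cons_val', Matrix.cons_val_zero, Matrix.cons_val_one, add_mul, neg_neg, mul_neg,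
      mul_assoc, h1', h2', smul_add, smul_neg] <;>
    simp only [← mul_assoc, key, h.e00, h.e11, h.e01, h.e10, mul_add, mul_smul_comm]
  · have i1 := ex (U 0 0) hL.e00_00
    have i2 := ex (U 1 1) hL.e00_11
    have i3 := ex (U 0 1) hL.e00_01
    have i4 := ex (U 1 0) hL.e00_10
    simp only [add_mul, sub_mul, neg_mul, smul_mul_assoc] at i1 i2 i3 i4
    linear_combination (norm := module) -i1 - i2 - i3 - i4
  · have i1 := ex (U 0 0) hL.e11_00
    have i2 := ex (U 1 1) hL.e11_11
    have i3 := ex (U 0 1) hL.e11_01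
    have i4 := ex (U 1 0) hL.e11_10
    simp only [add_mul, sub_mul, neg_mul, smul_mul_assoc] at i1 i2 i3 i4
    linear_combination (norm := module) -i1 - i2 - i3 - i4
  · have i1 := ex (U 0 0) hL.e01_00
    have i2 := ex (U 1 1) hL.e01_11
    have i3 := ex (U 0 1) hL.e01_01
    have i4 := ex (U 1 0) hL.e01_10
    simp only [add_mul, sub_mul, neg_mul, smul_mul_assoc] at i1 i2 
    rw [i3, i4]
    linear_combination (norm := module) -i1 - i2
  · have i1 := ex (U 0 0) hL.e10_00
    have i2 := ex (U 1 1) hL.e10_11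
    have i3 := ex (U 0 1) hL.e10_01
    have i4 := ex (U 1 0) hL.e10_10
    simp only [add_mul, sub_mul, neg_mul, smul_mul_assoc] at i1 i2 
    rw [i3, i4]
    linear_combination (norm := module) -i1 - i2

/-- the relation between `U(λ)` and `U(-λ)` -/
structure Par (U U' : Matrix (Fin 2) (Fin 2) R) : Prop where
  e00 : U' 0 0 = -U 0 0
  e11 : U' 1 1 = -U 1 1
  e01 : U' 0 1 = U 0 1
  e10 : U' 1 0 = U 1 0

lemma Par.dress {U U' L L' J J' : Matrix (Fin 2) (Fin 2) R} (h : Par U U')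
    (hL : Par L L') (hJ : Par J J') : Par (L * U * -adj2 J) (L' * U' * -adj2 J') := by
  constructor <;>
    simp [adj2, Matrix.mul_apply, Fin.sum_univ_two, h.e00, h.e11, h.e01, h.e10,
      hL.e00, hL.e11, hL.e01, hL.e10, hJ.e00, hJ.e11, hJ.e01, hJ.e10] <;> noncomm_ring

end dressing

lemma mul2_apply {R : Type*} [Ring R] (A B : Matrix (Fin 2) (Fin 2) R) (i j : Fin 2) :
    (A * B) i j = A i 0 * B 0 j + A i 1 * B 1 j := by
  simp [Matrix.mul_apply, Fin.sum_univ_two]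

section chain
variable {l N : ℕ}

lemma laxSite_par (q s : ℂ) (P : BulkParams N) (n : Fin N) (lam : ℂ) :
    Par (laxSite l N q s P n (lam / s)) (laxSite l N q s P n (-lam / s)) := by
  constructor <;> simp only [laxSite, Matrix.of_apply, ← site_neg] <;>
    refine congrArg (site l N n) ?_
  · simp [laxM, neg_div, div_neg]; abel
  · simp [laxM, neg_div, div_neg]; abel
  · simp [laxM]
  · simp [laxM]

/-- ordered product of Lax operators along a list of sites -/
def monoL (q s : ℂ) (P : BulkParams N) (ns : List (Fin N)) (lam : ℂ) :
    Matrix (Fin 2) (Fin 2) (Op l N) :=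
  (ns.map fun n => laxSite l N q s P n (lam / s)).prod

/-- boundary monodromy along a list of sites -/
def uL (q s : ℂ) (P : BulkParams N) (Bm : Bdry) (ns : List (Fin N)) (lam : ℂ) :
    Matrix (Fin 2) (Fin 2) (Op l N) :=
  monoL q s P ns lam * lift2 l N (kM q s Bm lam) *
    (((-1 : ℂ) ^ ns.length) • adj2 (monoL q s P ns lam⁻¹))

lemma monoL_commute (q s : ℂ) (P : BulkParams N) (n : Fin N) (A : Matrix (Zp l) (Zp l) ℂ)
    (ns : List (Fin N)) (hn : n ∉ ns) (lam : ℂ) (i j : Fin 2) :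
    Commute (site l N n A) (monoL q s P ns lam i j) := by
  induction ns generalizing i j with
  | nil =>
    simp only [monoL, List.map_nil, List.prod_nil, Matrix.one_apply]
    split_ifs
    · exact Commute.one_right _
    · exact Commute.zero_right _
  | cons m ns ih =>
    simp only [List.mem_cons, not_or] at hn
    simp only [monoL, List.map_cons, List.prod_cons, Matrix.mul_apply, Fin.sum_univ_two]
    have ih' := ih hn.2
    simp only [monoL] at ih'
    exact ((site_commute hn.1 _ _).mul_right (ih' _ _)).add_right
      ((site_commute hn.1 _ _).mul_right (ih' _ _))

lemma commute_mul2 {R : Type*} [Ring R] (x : R) (A B : Matrix (Fin 2) (Fin 2) R)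
    (hA : ∀ i j, Commute x (A i j)) (hB : ∀ i j, Commute x (B i j)) (i j : Fin 2) :
    Commute x ((A * B) i j) := by
  simp only [Matrix.mul_apply, Fin.sum_univ_two]
  exact ((hA _ _).mul_right (hB _ _)).add_right ((hA _ _).mul_right (hB _ _))

lemma uL_commute (q s : ℂ) (P : BulkParams N) (Bm : Bdry) (n : Fin N)
    (A : Matrix (Zp l) (Zp l) ℂ)
    (ns : List (Fin N)) (hn : n ∉ ns) (lam : ℂ) (i j : Fin 2) :
    Commute (site l N n A) (uL q s P Bm ns lam i j) := by
  have h := fun lam => monoL_commute q s P n A ns hn lam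
  refine commute_mul2 _ _ _ (fun i j => commute_mul2 _ _ _ (h _) ?_ i j) ?_ i j
  · intro i j
    simp only [lift2, Matrix.of_apply]
    exact (Commute.one_right _).smul_right _
  · intro i j
    rw [Matrix.smul_apply]
    refine Commute.smul_right ?_ _
    fin_cases i <;> fin_cases j <;> simp [adj2, h]

lemma uL_cons (q s : ℂ) (P : BulkParams N) (Bm : Bdry) (n : Fin N)
    (ns : List (Fin N)) (hn : n ∉ ns) (lam : ℂ) :
    uL (l := l) q s P Bm (n :: ns) lam =
      laxSite l N q s P n (lam / s) * uL q s P Bm ns lam *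
        -adj2 (laxSite l N q s P n (lam⁻¹ / s)) := by
  have e : ∀ lam, monoL (l := l) q s P (n :: ns) lam =
      laxSite l N q s P n (lam / s) * monoL q s P ns lam := fun lam => by
    simp [monoL]
  unfold uL
  rw [e, e, adj2_mul (laxSite l N q s P n (lam⁻¹ / s)) (monoL q s P ns lam⁻¹)
    (fun i j k m => monoL_commute q s P n _ ns hn _ k m)]
  simp only [List.length_cons, pow_succ, mul_neg, mul_one, neg_smul, mul_smul_comm,
    smul_mul_assoc, mul_assoc]

lemma uL_rel (q s : ℂ) (P : BulkParams N) (hP : P.NonZero) (Bm : Bdry) (lam : ℂ)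
    (hs : s ^ 2 = q) (hq0 : q ≠ 0) (hq : q ^ (2 * l + 1) = 1) (hlam : lam ≠ 0)
    (ns : List (Fin N)) (hns : ns.Nodup) :
    Rel (lam ^ 2 / q - q / lam ^ 2) (q⁻¹ - q) (lam ^ 2 - (lam ^ 2)⁻¹)
      (-(q * lam ^ 2 - (q * lam ^ 2)⁻¹))
      (uL (l := l) q s P Bm ns lam) (uL q s P Bm ns lam⁻¹) := by
  induction ns with
  | nil =>
    have hs0 : s ≠ 0 := by rintro rfl; simp at hs; exact hq0 hs.symm
    have hid : adj2 (1 : Matrix (Fin 2) (Fin 2) (Op l N)) = 1 := by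
      ext i j : 1
      fin_cases i <;> fin_cases j <;> simp [adj2]
    have hu : ∀ lam, uL (l := l) q s P Bm [] lam = lift2 l N (kM q s Bm lam) := by
      intro lam
      simp [uL, monoL, hid]
    rw [hu, hu]
    by_cases hz : Bm.ζ = 0
    · constructor <;> simp [lift2, kM, hz]
    subst hs
    constructor <;> simp only [lift2, Matrix.of_apply, smul_smul, ← add_smul] <;>
      refine congrArg (· • (1 : Op l N)) ?_ <;>
      simp [kM] <;> generalize (Bm.ζ - Bm.ζ⁻¹)⁻¹ = ze <;> field_simp <;> ring
  | cons n ns ih =>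
    rw [List.nodup_cons] at hns
    rw [uL_cons _ _ _ _ _ _ hns.1, uL_cons _ _ _ _ _ _ hns.1, inv_inv]
    exact (ih hns.2).dress (laxSite_locId l N q s P hP n lam hs hq0 hq hlam)
      (fun i j k m => uL_commute _ _ _ _ _ _ _ hns.1 _ _ _)
      (fun i j k m => uL_commute _ _ _ _ _ _ _ hns.1 _ _ _)

lemma kM_par (q s : ℂ) (B : Bdry) (lam : ℂ) : Par (kM q s B lam) (kM q s B (-lam)) := by
  constructor <;> simp [kM, neg_div, div_neg] <;> ring

lemma uL_par (q s : ℂ) (P : BulkParams N) (Bm : Bdry) (lam : ℂ)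
    (ns : List (Fin N)) (hns : ns.Nodup) :
    Par (uL (l := l) q s P Bm ns lam) (uL q s P Bm ns (-lam)) := by
  induction ns with
  | nil =>
    have hid : adj2 (1 : Matrix (Fin 2) (Fin 2) (Op l N)) = 1 := by
      ext i j : 1
      fin_cases i <;> fin_cases j <;> simp [adj2]
    have hu : ∀ lam, uL (l := l) q s P Bm [] lam = lift2 l N (kM q s Bm lam) := by
      intro lam
      simp [uL, monoL, hid]
    rw [hu, hu]
    have h := kM_par q s Bm lam
    constructor <;> simp only [lift2, Matrix.of_apply, h.e00, h.e01, h.e10, h.e11, neg_smul]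
  | cons n ns ih =>
    rw [List.nodup_cons] at hns
    rw [uL_cons _ _ _ _ _ _ hns.1, uL_cons _ _ _ _ _ _ hns.1]
    refine (ih hns.2).dress (laxSite_par q s P n lam) ?_
    have := laxSite_par (l := l) q s P n lam⁻¹
    rwa [← inv_neg] at this

lemma uBdry_eq (q s : ℂ) (P : BulkParams N) (Bm : Bdry) (lam : ℂ) :
    uBdry l N q s P Bm lam = uL q s P Bm (List.finRange N).reverse lam := by
  have h : ∀ M : Matrix (Fin 2) (Fin 2) (Op l N),
      sigY l N * M.transpose * sigY l N = adj2 M := by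
    intro M
    ext i j : 1
    fin_cases i <;> fin_cases j <;>
      rw [mul2_apply, mul2_apply, mul2_apply] <;>
      simp [sigY, adj2, smul_smul]
  simp only [uBdry, uL, mHat, h, List.length_reverse, List.length_finRange]
  rfl

lemma nodup_rev : (List.finRange N).reverse.Nodup :=
  List.nodup_reverse.mpr (List.nodup_finRange N)

end chain

lemma transferGen_eq (l N : ℕ) (q s : ℂ) (P : BulkParams N) (Bp Bm : Bdry) (lam : ℂ) :
    transferGen l N q s P Bp Bm lam =
      (kM q s Bp (lam * q) 0 0 • opA l N q s P Bm lam +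
        kM q s Bp (lam * q) 1 1 • opD l N q s P Bm lam) +
      (kM q s Bp (lam * q) 0 1 • opC l N q s P Bm lam +
        kM q s Bp (lam * q) 1 0 • opB l N q s P Bm lam) := by
  simp only [transferGen, Matrix.trace, Matrix.diag, mul2_apply,
    Fin.sum_univ_two, lift2, Matrix.of_apply, smul_mul_assoc, one_mul, opA, opB, opC, opD]
  abel

lemma diag_forms (q s ζ lam : ℂ) (hs0 : s ≠ 0) (hs : s ^ 2 = q) (hlam : lam ≠ 0)
    (h4 : lam ^ 4 ≠ 1) {V : Type*} [AddCommGroup V] [Module ℂ V] (B : Bdry) (hB : B.ζ = ζ)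
    (A A' D D' : V)
    (h1 : (lam ^ 2 / q - q / lam ^ 2) • A' = (q⁻¹ - q) • A + (lam ^ 2 - (lam ^ 2)⁻¹) • D)
    (h2 : (lam ^ 2 / q - q / lam ^ 2) • D' = (lam ^ 2 - (lam ^ 2)⁻¹) • A + (q⁻¹ - q) • D) :
    kM q s B (lam * q) 0 0 • A + kM q s B (lam * q) 1 1 • D =
        aPl q s ζ lam • A + aPl q s ζ lam⁻¹ • A' ∧
    kM q s B (lam * q) 0 0 • A + kM q s B (lam * q) 1 1 • D =
        dPl q s ζ lam • D + dPl q s ζ lam⁻¹ • D' := by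
  subst hB
  by_cases hz : B.ζ = 0
  · simp [aPl, dPl, kM, hz]
  have h4' : lam ^ 4 - 1 ≠ 0 := sub_ne_zero.mpr h4
  have h5 : lam ^ 2 - 1 / lam ^ 2 ≠ 0 := by
    intro h; apply h4'; field_simp at h; linear_combination h
  have ea : aPl q s B.ζ lam⁻¹ = (B.ζ - B.ζ⁻¹)⁻¹ * (B.ζ / (lam * s) - s * lam / B.ζ) /
      (lam ^ 2 - 1 / lam ^ 2) * (lam ^ 2 / q - q / lam ^ 2) := by
    have : (lam⁻¹ ^ 2 - 1 / lam⁻¹ ^ 2) = -(lam ^ 2 - 1 / lam ^ 2) := by simp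
    unfold aPl
    rw [this]
    generalize lam ^ 2 - 1 / lam ^ 2 = y at *
    rw [div_eq_mul_inv, mul_inv]
    generalize (B.ζ - B.ζ⁻¹)⁻¹ = ze
    subst hs
    field_simp
    ring
  have ed : dPl q s B.ζ lam⁻¹ = (B.ζ - B.ζ⁻¹)⁻¹ * (B.ζ * s * lam - 1 / (lam * s * B.ζ)) /
      (lam ^ 2 - 1 / lam ^ 2) * (lam ^ 2 / q - q / lam ^ 2) := by
    have : (lam⁻¹ ^ 2 - 1 / lam⁻¹ ^ 2) = -(lam ^ 2 - 1 / lam ^ 2) := by simp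
    unfold dPl
    rw [this]
    generalize lam ^ 2 - 1 / lam ^ 2 = y at *
    rw [div_eq_mul_inv, mul_inv]
    generalize (B.ζ - B.ζ⁻¹)⁻¹ = ze
    subst hs
    field_simp
    ring
  have ea' : aPl q s B.ζ lam = (B.ζ - B.ζ⁻¹)⁻¹ * ((lam ^ 2 * q - 1 / (q * lam ^ 2)) *
      (lam * B.ζ / s - s / (lam * B.ζ))) / (lam ^ 2 - 1 / lam ^ 2) := by
    unfold aPl
    rw [div_eq_mul_inv, mul_inv]; ring
  have ed' : dPl q s B.ζ lam = (B.ζ - B.ζ⁻¹)⁻¹ * ((lam ^ 2 * q - 1 / (q * lam ^ 2)) *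
      (B.ζ * s / lam - lam / (s * B.ζ))) / (lam ^ 2 - 1 / lam ^ 2) := by
    unfold dPl
    rw [div_eq_mul_inv, mul_inv]; ring
  rw [ea, ed, ea', ed', mul_smul, mul_smul, h1, h2]
  have h6 : lam ^ 2 - 1 / lam ^ 2 = (lam ^ 4 - 1) / lam ^ 2 := by field_simp
  rw [h6]
  subst hs
  constructor <;> match_scalars <;> simp [kM] <;>
    generalize (B.ζ - B.ζ⁻¹)⁻¹ = ze <;> field_simp <;> ring

end SixV

namespace SixV

/-- symmetries of the transfer matrix and the two symmetric forms of
its diagonal part `T_∖(λ) = a_+(λ) A_-(λ) + d_+(λ) D_-(λ)`. -/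
theorem transfer_symmetries (l N : ℕ) (hl : 1 ≤ l) (hN : 1 ≤ N) (q s : ℂ)
    (hq : IsPrimitiveRoot q (2 * l + 1)) (hs : s ^ 2 = q)
    (P : BulkParams N) (hP : P.NonZero)
    (Bp Bm : Bdry) (hζp : Bp.ζ ^ 2 ≠ 1) (hζm : Bm.ζ ^ 2 ≠ 1) :
    (∀ lam : ℂ, lam ≠ 0 →
      transferGen l N q s P Bp Bm lam⁻¹ = transferGen l N q s P Bp Bm lam ∧
      transferGen l N q s P Bp Bm (-lam) = transferGen l N q s P Bp Bm lam) ∧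
    (∀ lam : ℂ, lam ≠ 0 → lam ^ 4 ≠ 1 →
      kM q s Bp (lam * q) 0 0 • opA l N q s P Bm lam +
          kM q s Bp (lam * q) 1 1 • opD l N q s P Bm lam =
        aPl q s Bp.ζ lam • opA l N q s P Bm lam +
          aPl q s Bp.ζ lam⁻¹ • opA l N q s P Bm lam⁻¹ ∧
      kM q s Bp (lam * q) 0 0 • opA l N q s P Bm lam +
          kM q s Bp (lam * q) 1 1 • opD l N q s P Bm lam =
        dPl q s Bp.ζ lam • opD l N q s P Bm lam +
          dPl q s Bp.ζ lam⁻¹ • opD l N q s P Bm lam⁻¹) := by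
  have hq1 : q ^ (2 * l + 1) = 1 := hq.pow_eq_one
  have hq0 : q ≠ 0 := hq.ne_zero (by omega)
  have hs0 : s ≠ 0 := by rintro rfl; simp at hs; exact hq0 hs.symm
  have rel : ∀ lam : ℂ, lam ≠ 0 → Rel (lam ^ 2 / q - q / lam ^ 2) (q⁻¹ - q)
      (lam ^ 2 - (lam ^ 2)⁻¹) (-(q * lam ^ 2 - (q * lam ^ 2)⁻¹))
      (uBdry l N q s P Bm lam) (uBdry l N q s P Bm lam⁻¹) := fun lam hlam => by
    rw [uBdry_eq, uBdry_eq]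
    exact uL_rel q s P hP Bm lam hs hq0 hq1 hlam _ nodup_rev
  have par : ∀ lam : ℂ, Par (uBdry l N q s P Bm lam) (uBdry l N q s P Bm (-lam)) := fun lam => by
    rw [uBdry_eq, uBdry_eq]
    exact uL_par q s P Bm lam _ nodup_rev
  have forms := fun (lam : ℂ) (hlam : lam ≠ 0) (h4 : lam ^ 4 ≠ 1) =>
    diag_forms q s Bp.ζ lam hs0 hs hlam h4 Bp rfl (opA l N q s P Bm lam) (opA l N q s P Bm lam⁻¹)
      (opD l N q s P Bm lam) (opD l N q s P Bm lam⁻¹) (rel lam hlam).e00 (rel lam hlam).e11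
  have parT : ∀ lam : ℂ, transferGen l N q s P Bp Bm (-lam) = transferGen l N q s P Bp Bm lam := by
    intro lam
    have h := par lam
    have k := kM_par q s Bp (lam * q)
    rw [transferGen_eq, transferGen_eq, neg_mul]
    simp only [opA, opB, opC, opD, h.e00, h.e01, h.e10, h.e11, k.e00, k.e01, k.e10, k.e11,
      neg_smul, smul_neg, neg_neg]
  refine ⟨fun lam hlam => ⟨?_, parT lam⟩, forms⟩
  by_cases h4 : lam ^ 4 = 1
  · have : (lam - 1) * (lam + 1) * (lam ^ 2 + 1) = 0 := by linear_combination h4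
    rcases mul_eq_zero.mp this with h | h
    · rcases mul_eq_zero.mp h with h | h
      · rw [sub_eq_zero.mp h, inv_one]
      · rw [eq_neg_of_add_eq_zero_left h, inv_neg, inv_one]
    · have : lam⁻¹ = -lam := by
        rw [inv_eq_iff_eq_inv]
        refine eq_inv_of_mul_eq_one_left ?_
        linear_combination -h
      rw [this, parT]
  · have f1 := (forms lam hlam h4).1
    have f2 := (forms lam⁻¹ (inv_ne_zero hlam) (by rw [inv_pow]; simpa using h4)).1
    rw [transferGen_eq, transferGen_eq, f1, f2, inv_inv, add_comm (aPl q s Bp.ζ lam⁻¹ • _)]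
    congr 1
    have off : ∀ (c : ℂ) (X X' : Op l N),
        (lam ^ 2 / q - q / lam ^ 2) • X' = -(q * lam ^ 2 - (q * lam ^ 2)⁻¹) • X →
        (c * ((lam⁻¹ * q) ^ 2 / q - q / (lam⁻¹ * q) ^ 2)) • X' =
          (c * ((lam * q) ^ 2 / q - q / (lam * q) ^ 2)) • X := by
      intro c X X' h
      have e1 : (lam⁻¹ * q) ^ 2 / q - q / (lam⁻¹ * q) ^ 2 =
          -(lam ^ 2 / q - q / lam ^ 2) := by field_simp; ring
      have e2 : (lam * q) ^ 2 / q - q / (lam * q) ^ 2 =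
          q * lam ^ 2 - (q * lam ^ 2)⁻¹ := by field_simp
      rw [e1, e2, mul_smul, mul_smul, neg_smul, h, neg_smul, neg_neg]
    have hC := off ((Bp.ζ - Bp.ζ⁻¹)⁻¹ * (Bp.κ * Complex.exp Bp.τ)) _ _ (rel lam hlam).e10
    have hB := off ((Bp.ζ - Bp.ζ⁻¹)⁻¹ * (Bp.κ * Complex.exp (-Bp.τ))) _ _ (rel lam hlam).e01
    have k01 : ∀ x, kM q s Bp x 0 1 = (Bp.ζ - Bp.ζ⁻¹)⁻¹ * (Bp.κ * Complex.exp Bp.τ) *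
        (x ^ 2 / q - q / x ^ 2) := fun x => by simp [kM, mul_assoc]
    have k10 : ∀ x, kM q s Bp x 1 0 = (Bp.ζ - Bp.ζ⁻¹)⁻¹ * (Bp.κ * Complex.exp (-Bp.τ)) *
        (x ^ 2 / q - q / x ^ 2) := fun x => by simp [kM, mul_assoc]
    rw [k01, k01, k10, k10]
    exact congrArg₂ (· + ·) hC hB

end SixV
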